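/- Every finite nontrivial tree T with no strong support vertices has an independent [1,2]-set. -/

import Mathlib

/-- A set of vertices is independent: no two of its vertices are adjacent. -/
def IndepSet {V : Type*} (G : SimpleGraph V) (S : Set V) : Prop :=
  ∀ u ∈ S, ∀ w ∈ S, ¬ G.Adj u w

/-- An independent [1,2]-set: an independent set such that every vertex outside it
has at least one and at most two neighbors in it. -/
def IsInd12Set {V : Type*} (G : SimpleGraph V) (S : Set V) : Prop :=
  IndepSet G S ∧
    ∀ u ∉ S, 1 ≤ (S ∩ G.neighborSet u).ncard ∧ (S ∩ G.neighborSet u).ncard ≤ 2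

/-- A leaf: a vertex of degree 1. -/
def IsLeaf {V : Type*} (G : SimpleGraph V) (w : V) : Prop :=
  (G.neighborSet w).ncard = 1

/-- A strong support vertex: a vertex having at least two leaves in its neighborhood. -/
def IsStrongSupport {V : Type*} (G : SimpleGraph V) (u : V) : Prop :=
  2 ≤ ({w | w ∈ G.neighborSet u ∧ IsLeaf G w}).ncard

/-- Parent function of a tree rooted at `r`. -/
theorem exists_parent {V : Type*} (T : SimpleGraph V) (h : T.IsTree) (r : V) :
    ∃ (p : V → V) (l : V → ℕ), (∀ v, v ≠ r → T.Adj v (p v) ∧ l (p v) < l v) ∧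
      (∀ u w, T.Adj u w → (w ≠ r ∧ p w = u) ∨ (u ≠ r ∧ p u = w)) := by
  classical
  have hex : ∀ v, ∃ q : T.Walk v r, q.IsPath ∧ ∀ q' : T.Walk v r, q'.IsPath → q' = q := by
    intro v
    obtain ⟨q, hq, hu⟩ := h.existsUnique_path v r
    exact ⟨q, hq, fun q' hq' => hu q' hq'⟩
  choose P hP hPu using hex
  refine ⟨fun v => (P v).snd, fun v => (P v).length, ?_, ?_⟩
  · intro v hv
    have hn : ¬ (P v).Nil := SimpleGraph.Walk.not_nil_of_ne hv
    refine ⟨(P v).adj_snd hn, ?_⟩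
    have h1 : (P v).tail = P (P v).snd := hPu _ _ (hP v).tail
    have h2 := SimpleGraph.Walk.length_tail_add_one hn
    show (P (P v).snd).length < (P v).length
    rw [← h1]; omega
  · intro u w huw
    by_cases hu : u ∈ (P w).support
    · left
      have hwr : w ≠ r := by
        rintro rfl
        have := hPu w SimpleGraph.Walk.nil (by simp)
        rw [← this] at hu
        simp at hu
        exact huw.ne hu
      refine ⟨hwr, ?_⟩
      have h1 : ((P w).takeUntil u hu).IsPath := (hP w).takeUntil hu
      have h2 : (SimpleGraph.Walk.cons huw.symm SimpleGraph.Walk.nil).IsPath := by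
        simp [huw.ne.symm]
      have h3 := (h.existsUnique_path w u).unique h1 h2
      have h4 := (P w).take_spec hu
      rw [h3] at h4
      show (P w).snd = u
      rw [← h4]
      simp
    · right
      have h1 : (SimpleGraph.Walk.cons huw (P w)).IsPath := by
        simp [hu, hP w]
      have h2 := hPu u _ h1
      refine ⟨?_, ?_⟩
      · rintro rfl
        exact hu (P w).end_mem_support
      · show (P u).snd = w
        rw [← h2]; simp

theorem statement5 {V : Type*} [Fintype V] [Nontrivial V] (T : SimpleGraph V)
    (htree : T.IsTree) (hnss : ∀ u : V, ¬ IsStrongSupport T u) :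
    ∃ S : Set V, IsInd12Set T S := by
  classical
  obtain ⟨r⟩ := htree.1.nonempty
  obtain ⟨p, l, hp, hadj⟩ := exists_parent T htree r
  -- favourite child
  have hf : ∀ u, ∃ c, ((∃ x, x ≠ r ∧ p x = u) → c ≠ r ∧ p c = u) ∧
      ((∃ x, x ≠ r ∧ p x = u ∧ IsLeaf T x) → IsLeaf T c) := by
    intro u
    by_cases h1 : ∃ x, x ≠ r ∧ p x = u ∧ IsLeaf T x
    · obtain ⟨x, a, b, c⟩ := h1
      exact ⟨x, fun _ => ⟨a, b⟩, fun _ => c⟩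
    · by_cases h2 : ∃ x, x ≠ r ∧ p x = u
      · obtain ⟨x, hx⟩ := h2
        exact ⟨x, fun _ => hx, fun h => absurd h h1⟩
      · exact ⟨u, fun h => absurd h h2, fun h => absurd h h1⟩
  choose f hf1 hf2 using hf
  obtain ⟨s, hs⟩ : ∃ s : V → Prop, ∀ v, s v ↔ (v = r ∨ (v ≠ r ∧ ¬ s (p v) ∧ f (p v) = v)) := by
    let F : (v : V) → ((w : V) → l w < l v → Prop) → Prop := fun v ih =>
      v = r ∨ ∃ h : v ≠ r, ¬ ih (p v) (hp v h).2 ∧ f (p v) = v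
    refine ⟨(measure l).wf.fix F, fun v => ?_⟩
    rw [WellFounded.fix_eq]
    simp only [F, exists_prop]
  refine ⟨{v | s v}, ?_, ?_⟩
  · have key : ∀ u w, s u → s w → ¬ (w ≠ r ∧ p w = u) := by
      rintro u w hu hw ⟨h1, rfl⟩
      rcases (hs w).1 hw with h | h
      · exact h1 h
      · exact h.2.1 hu
    intro u hu w hw h
    rcases hadj u w h with h | h
    · exact key u w hu hw h
    · exact key w u hw hu h
  · intro u hu
    have hu' : ¬ s u := hu
    have hur : u ≠ r := fun h => hu' ((hs u).2 (Or.inl h))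
    constructor
    · rw [Nat.succ_le_iff, Set.ncard_pos (Set.toFinite _)]
      by_cases hpu : s (p u)
      · exact ⟨p u, hpu, (hp u hur).1⟩
      · have hfu : f (p u) ≠ u := fun h => hu' ((hs u).2 (Or.inr ⟨hur, hpu, h⟩))
        have hc := hf1 (p u) ⟨u, hur, rfl⟩
        have hnl : ¬ IsLeaf T u := by
          intro hl
          have hl2 := hf2 (p u) ⟨u, hur, rfl, hl⟩
          apply hnss (p u)
          have : ({f (p u), u} : Set V) ⊆ {w | w ∈ T.neighborSet (p u) ∧ IsLeaf T w} := by
            rintro x (rfl | rfl)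
            · refine ⟨?_, hl2⟩
              have := (hp _ hc.1).1
              rw [hc.2] at this
              exact this.symm
            · exact ⟨(hp _ hur).1.symm, hl⟩
          have h2 := Set.ncard_le_ncard this (Set.toFinite _)
          rwa [Set.ncard_pair hfu] at h2
        have hch : ∃ x, x ≠ r ∧ p x = u := by
          by_contra hno
          apply hnl
          have : T.neighborSet u = {p u} := by
            ext x
            constructor
            · intro hx
              rcases hadj u x hx with h | h
              · exact absurd ⟨x, h⟩ hno
              · exact h.2.symm
            · rintro rfl
              exact (hp u hur).1
          unfold IsLeaf
          rw [this, Set.ncard_singleton]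
        have hc2 := hf1 u hch
        refine ⟨f u, (hs _).2 (Or.inr ⟨hc2.1, ?_, ?_⟩), ?_⟩
        · rw [hc2.2]; exact hu'
        · rw [hc2.2]
        · have := (hp _ hc2.1).1
          rw [hc2.2] at this
          exact this.symm
    · have : {v | s v} ∩ T.neighborSet u ⊆ {p u, f u} := by
        rintro x ⟨hx, hux⟩
        rcases hadj u x hux with h | h
        · right
          rcases (hs x).1 hx with h' | h'
          · exact absurd h' h.1
          · have := h'.2.2
            rw [h.2] at this
            exact this.symm
        · left; exact h.2.symm
      exact (Set.ncard_le_ncard this (Set.toFinite _)).trans ((Set.ncard_insert_le _ _).trans (by simp))
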